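/- arXiv:2105.06944 — 2 statements merged into one kernel-verified Lean document; each statement's English description precedes it below -/
import Mathlib

section
/- (Core inequality of the free-after-rejection lemma) Let c ∈ [0, 1/2) and let F_u, F_w be events in a probability space satisfying: (i) Pr[F_u ∩ F_w] ≤ Pr[F_u]·Pr[F_w] + 6c; (ii) Pr[F_u] ≥ 1/2 − c; and let q ∈ [0,1] satisfy (iii) 1 − q·Pr[F_w] ≥ 1/2 − c. Then Pr[F_u] − q·Pr[F_u ∩ F_w] ≥ Pr[F_u]·(1 − q·Pr[F_w])·(1 − 6c/(1/2 − c)²). -/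
open MeasureTheory

/-- **Core inequality of the free-after-rejection lemma.** If the events `Fu, Fw`
satisfy `Pr[Fu ∩ Fw] ≤ Pr[Fu]·Pr[Fw] + 6c`, `Pr[Fu] ≥ 1/2 - c`, and
`1 - q·Pr[Fw] ≥ 1/2 - c` for `q ∈ [0,1]` and `c ∈ [0, 1/2)`, then
`Pr[Fu] - q·Pr[Fu ∩ Fw] ≥ Pr[Fu]·(1 - q·Pr[Fw])·(1 - 6c/(1/2 - c)²)`. -/
theorem free_after_rejection_core {Ω : Type*} [MeasurableSpace Ω] (μ : Measure Ω)
    [IsProbabilityMeasure μ] (c : ℝ) (hc : c ∈ Set.Ico (0:ℝ) (1/2))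
    (Fu Fw : Set Ω) (hFu : MeasurableSet Fu) (hFw : MeasurableSet Fw)
    (q : ℝ) (hq : q ∈ Set.Icc (0:ℝ) 1)
    (hcorr : (μ (Fu ∩ Fw)).toReal ≤ (μ Fu).toReal * (μ Fw).toReal + 6 * c)
    (hFuLB : 1/2 - c ≤ (μ Fu).toReal)
    (hqFw : 1/2 - c ≤ 1 - q * (μ Fw).toReal) :
    (μ Fu).toReal * (1 - q * (μ Fw).toReal) * (1 - 6 * c / (1/2 - c)^2) ≤
      (μ Fu).toReal - q * (μ (Fu ∩ Fw)).toReal := by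
  obtain ⟨hc0, hc1⟩ := hc
  obtain ⟨hq0, hq1⟩ := hq
  have hd : 0 < 1/2 - c := by linarith
  have hprod : (1/2 - c)^2 ≤ (μ Fu).toReal * (1 - q * (μ Fw).toReal) := by
    rw [sq]
    exact mul_le_mul hFuLB hqFw hd.le (hd.le.trans hFuLB)
  have hloss : 6 * c ≤ (μ Fu).toReal * (1 - q * (μ Fw).toReal) * (6 * c / (1/2 - c)^2) := by
    calc 6 * c = (1/2 - c)^2 * (6 * c / (1/2 - c)^2) := (mul_div_cancel₀ _ (pow_pos hd 2).ne').symm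
      _ ≤ _ := mul_le_mul_of_nonneg_right hprod (by positivity)
  have hinter := mul_le_mul_of_nonneg_left hcorr hq0
  have hqc : q * (6 * c) ≤ 6 * c := mul_le_of_le_one_left (by positivity) hq1
  linarith
end

section
/- (Lower-tail bound for adaptively lower-bounded Bernoulli sums) Let X_1, …, X_m be {0,1}-valued random variables on a probability space and p_1, …, p_m ∈ [0,1] such that for every i ∈ {1,…,m} and every x ∈ {0,1}^{i−1} with Pr[X_1 = x_1, …, X_{i−1} = x_{i−1}] > 0, one has Pr[X_i = 1 | X_1 = x_1, …, X_{i−1} = x_{i−1}] ≥ p_i. Let μ = p_1 + … + p_m and suppose μ > 0. Then for every ε ∈ (0,1), Pr[X_1 + … + X_m ≤ μ·(1−ε)] ≤ exp(−μ·ε²/2). -/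
open MeasureTheory ProbabilityTheory

theorem Real.exp_neg_le_one_sub_add_sq_div_two {x : ℝ} (hx : 0 ≤ x) :
    Real.exp (-x) ≤ 1 - x + x ^ 2 / 2 := by
  have h := Real.quadratic_le_exp_of_nonneg hx
  rw [Real.exp_neg, inv_le_iff_one_le_mul₀ (Real.exp_pos x)]
  have hpos : 0 ≤ 1 - x + x ^ 2 / 2 := by nlinarith [sq_nonneg (x - 1)]
  nlinarith [mul_le_mul_of_nonneg_left h hpos, sq_nonneg (x ^ 2)]

/-- If an event has conditional probability at least `c` on every fiber of a finitely valued map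
`B`, then integrating a nonnegative function of `B` over the event keeps at least a fraction `c`
of its integral. -/
theorem mul_integral_le_setIntegral_of_fiber {Ω α : Type*} [MeasurableSpace Ω] {μ : Measure Ω}
    [IsFiniteMeasure μ] [Fintype α] [MeasurableSpace α] [MeasurableSingletonClass α]
    {B : Ω → α} (hB : Measurable B) {g : α → ℝ} (hg : ∀ a, 0 ≤ g a) {A : Set Ω} {c : ℝ}
    (h : ∀ a, c * μ.real (B ⁻¹' {a}) ≤ μ.real (B ⁻¹' {a} ∩ A)) :
    c * ∫ ω, g (B ω) ∂μ ≤ ∫ ω in A, g (B ω) ∂μ := by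
  have key : ∀ ν : Measure Ω, IsFiniteMeasure ν →
      ∫ ω, g (B ω) ∂ν = ∑ a, ν.real (B ⁻¹' {a}) * g a := by
    intro ν _
    rw [← integral_map (f := g) hB.aemeasurable (measurable_of_finite g).aestronglyMeasurable,
      integral_fintype Integrable.of_finite]
    refine Finset.sum_congr rfl fun a _ => ?_
    rw [map_measureReal_apply hB (measurableSet_singleton a), smul_eq_mul]
  rw [key μ inferInstance, key (μ.restrict A) inferInstance, Finset.mul_sum]
  refine Finset.sum_le_sum fun a _ => ?_
  rw [measureReal_restrict_apply (hB (measurableSet_singleton a)), ← mul_assoc]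
  exact mul_le_mul_of_nonneg_right (h a) (hg a)

/-- The Laplace transform of an adaptively lower-bounded Bernoulli sum is at most that of a
Poisson variable with mean `∑ pⱼ`, along every initial segment of the variables. -/
theorem integral_exp_neg_partial_sum_le {Ω : Type*} [MeasurableSpace Ω] {μ : Measure Ω}
    [IsProbabilityMeasure μ] {m : ℕ} {X : Fin m → Ω → ℝ} {p : Fin m → ℝ}
    (hXmeas : ∀ i, Measurable (X i)) (hX01 : ∀ i ω, X i ω = 0 ∨ X i ω = 1)
    (hcond : ∀ (i : Fin m) (x : Fin m → ℝ), (∀ j, x j = 0 ∨ x j = 1) →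
      μ {ω | ∀ j, j < i → X j ω = x j} ≠ 0 →
      ENNReal.ofReal (p i) ≤ μ[|{ω | ∀ j, j < i → X j ω = x j}] {ω | X i ω = 1})
    {t : ℝ} (ht : 0 ≤ t) (k : ℕ) (hk : k ≤ m) :
    ∫ ω, Real.exp (-t * ∑ j with j.val < k, X j ω) ∂μ ≤
      Real.exp (-(1 - Real.exp (-t)) * ∑ j with j.val < k, p j) := by
  classical
  induction k with
  | zero => simp
  | succ k ih =>
    specialize ih (by omega)
    let i : Fin m := ⟨k, hk⟩
    have hfilter : (Finset.univ.filter fun j : Fin m => j.val < k + 1) =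
        insert i (Finset.univ.filter fun j : Fin m => j.val < k) := by
      ext j
      simp only [Finset.mem_filter, Finset.mem_univ, true_and, Finset.mem_insert, Fin.ext_iff, i]
      omega
    have hi : i ∉ Finset.univ.filter fun j : Fin m => j.val < k := by simp [i]
    let B : Ω → Fin m → Bool := fun ω j => decide (j < i ∧ X j ω = 1)
    have hB : Measurable B := by
      refine measurable_pi_iff.2 fun j => ?_
      refine measurable_to_bool ?_
      by_cases hj : j < i
      · have : (fun ω => B ω j) ⁻¹' {true} = X j ⁻¹' {1} := by
          ext ω; simp [B, hj]
        rw [this]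
        exact hXmeas j (measurableSet_singleton 1)
      · have : (fun ω => B ω j) ⁻¹' {true} = ∅ := by
          ext ω; simp [B, hj]
        rw [this]
        exact MeasurableSet.empty
    let g : (Fin m → Bool) → ℝ :=
      fun a => Real.exp (-t * ∑ j with j.val < k, if a j then 1 else 0)
    have hgB : ∀ ω, Real.exp (-t * ∑ j with j.val < k, X j ω) = g (B ω) := by
      intro ω
      simp only [g]
      congr 2
      refine Finset.sum_congr rfl fun j hj => ?_
      have hj' : j < i := by simpa [i, Fin.lt_def] using hj
      rcases hX01 j ω with h | h <;> simp [B, h, hj']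
    have hA : MeasurableSet {ω | X i ω = 1} := hXmeas i (measurableSet_singleton 1)
    have hfiber : ∀ a, p i * μ.real (B ⁻¹' {a}) ≤ μ.real (B ⁻¹' {a} ∩ {ω | X i ω = 1}) := by
      intro a
      by_cases h0 : μ (B ⁻¹' {a}) = 0
      · simp [Measure.real, h0]
      obtain ⟨ω₀, hω₀⟩ := nonempty_of_measure_ne_zero h0
      have hS : B ⁻¹' {a} = {ω | ∀ j, j < i → X j ω = X j ω₀} := by
        rw [Set.mem_preimage, Set.mem_singleton_iff] at hω₀
        ext ω
        simp only [Set.mem_preimage, Set.mem_singleton_iff, Set.mem_ofPred_eq, ← hω₀, funext_iff]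
        refine forall_congr' fun j => ?_
        by_cases hj : j < i
        · rcases hX01 j ω with h | h <;> rcases hX01 j ω₀ with h' | h' <;> simp [B, h, h', hj]
        · simp [B, hj]
      have hc := hcond i (fun j => X j ω₀) (fun j => hX01 j ω₀) (hS ▸ h0)
      rw [← hS] at hc
      have hc' := (ENNReal.ofReal_le_iff_le_toReal (measure_ne_top _ _)).1 hc
      rw [measureReal_def, measureReal_def, ← cond_mul_eq_inter (hB (measurableSet_singleton a)),
        ENNReal.toReal_mul]
      exact mul_le_mul_of_nonneg_right hc' ENNReal.toReal_nonneg
    have hint : Integrable (fun ω => g (B ω)) μ :=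
      (Integrable.of_finite (μ := μ.map B) (f := g)).comp_measurable hB
    have hle := mul_integral_le_setIntegral_of_fiber hB
      (fun a => (Real.exp_pos _).le : ∀ a, 0 ≤ g a) hfiber
    have hstep : ∀ ω, Real.exp (-t * ∑ j with j.val < k + 1, X j ω) =
        g (B ω) - (1 - Real.exp (-t)) * {ω | X i ω = 1}.indicator (fun ω => g (B ω)) ω := by
      intro ω
      rw [hfilter, Finset.sum_insert hi, mul_add, Real.exp_add, hgB]
      rcases hX01 i ω with h | h
      · simp [Set.indicator, h]
      · simp only [h, Set.indicator, Set.mem_ofPred_eq, if_true, mul_one]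
        ring
    simp only [hgB] at ih
    simp only [hstep]
    rw [integral_sub hint ((hint.indicator hA).const_mul _), integral_const_mul,
      integral_indicator hA, hfilter, Finset.sum_insert hi, mul_add, Real.exp_add]
    have hr : 0 ≤ 1 - Real.exp (-t) := by
      have := Real.exp_le_one_iff.2 (neg_nonpos.2 ht)
      linarith
    have hI : 0 ≤ ∫ ω, g (B ω) ∂μ := integral_nonneg fun ω => (Real.exp_pos _).le
    calc _ ≤ (-(1 - Real.exp (-t)) * p i + 1) * ∫ ω, g (B ω) ∂μ := by
          nlinarith [mul_le_mul_of_nonneg_left hle hr]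
      _ ≤ Real.exp (-(1 - Real.exp (-t)) * p i) * ∫ ω, g (B ω) ∂μ :=
          mul_le_mul_of_nonneg_right (Real.add_one_le_exp _) hI
      _ ≤ _ := mul_le_mul_of_nonneg_left ih (Real.exp_pos _).le

/-- **Lower-tail bound for adaptively lower-bounded Bernoulli sums.** If each binary
`Xᵢ` equals `1` with conditional probability at least `pᵢ` given any outcome of
`X₁, …, Xᵢ₋₁` of positive probability, and `μ = ∑ pᵢ > 0`, then for every `ε ∈ (0,1)`,
`Pr[∑ Xᵢ ≤ μ(1-ε)] ≤ exp(-μ ε² / 2)`. -/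
theorem adaptive_lower_tail {Ω : Type*} [MeasurableSpace Ω] (μ : Measure Ω)
    [IsProbabilityMeasure μ] {m : ℕ} (X : Fin m → Ω → ℝ) (p : Fin m → ℝ)
    (hp : ∀ i, p i ∈ Set.Icc (0:ℝ) 1)
    (hXmeas : ∀ i, Measurable (X i))
    (hX01 : ∀ i ω, X i ω = 0 ∨ X i ω = 1)
    (hcond : ∀ (i : Fin m) (x : Fin m → ℝ), (∀ j, x j = 0 ∨ x j = 1) →
      μ {ω | ∀ j, j < i → X j ω = x j} ≠ 0 →
      ENNReal.ofReal (p i) ≤ μ[|{ω | ∀ j, j < i → X j ω = x j}] {ω | X i ω = 1})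
    (hμpos : 0 < ∑ i, p i)
    (ε : ℝ) (hε : ε ∈ Set.Ioo (0:ℝ) 1) :
    (μ {ω | ∑ i, X i ω ≤ (∑ i, p i) * (1 - ε)}).toReal ≤
      Real.exp (-((∑ i, p i) * ε ^ 2) / 2) := by
  have hmgf : mgf (fun ω => ∑ i, X i ω) μ (-ε) ≤
      Real.exp (-(1 - Real.exp (-ε)) * ∑ i, p i) := by
    simpa [mgf] using integral_exp_neg_partial_sum_le hXmeas hX01 hcond hε.1.le m le_rfl
  have hint : Integrable (fun ω => Real.exp (-ε * ∑ i, X i ω)) μ := by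
    refine Integrable.of_bound (C := 1) (by fun_prop) (ae_of_all _ fun ω => ?_)
    rw [Real.norm_eq_abs, Real.abs_exp, Real.exp_le_one_iff]
    have : 0 ≤ ∑ i, X i ω := Finset.sum_nonneg fun i _ => by
      rcases hX01 i ω with h | h <;> simp [h]
    nlinarith [hε.1]
  refine (measure_le_le_exp_mul_mgf _ (neg_nonpos.2 hε.1.le) hint).trans ?_
  refine (mul_le_mul_of_nonneg_left hmgf (Real.exp_pos _).le).trans ?_
  rw [← Real.exp_add, Real.exp_le_exp]
  nlinarith [mul_le_mul_of_nonneg_left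
    (Real.exp_neg_le_one_sub_add_sq_div_two hε.1.le) hμpos.le]
end
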